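/- arXiv:1409.2556 — 5 statements merged into one kernel-verified Lean document; each statement's English description precedes it below -/
import Mathlib

section
/- Suppose that for each k = 1, …, N_z the matrix H_m(z_k; T_m) is invertible, the matrix A + z_k I is invertible, the flexible Arnoldi relation (A + z_k I) U_m = V_{m+1} H̄_m(z_k; T_m) holds, and b = β v_1. Define the approximate solutions x_m(z_k) = U_m H_m(z_k; T_m)^{-1} β e_1 and the quadrature error E_m = Σ_{k=1}^{N_z} w_k ( (A + z_k I)^{-1} b − x_m(z_k) ), where w_1, …, w_{N_z} are complex weights. Then E_m = − Σ_{k=1}^{N_z} w_k η_k (A + z_k I)^{-1} v_{m+1}, where η_k = h_{m+1,m} (z_k − τ_m) · (e_m^T H_m(z_k; T_m)^{-1} β e_1); in particular, E_m lies in the span of the vectors (A + z_1 I)^{-1} v_{m+1}, …, (A + z_{N_z} I)^{-1} v_{m+1}. -/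
open Matrix

/-- A matrix applied to a vector whose only possibly nonzero entries are the first and the last. -/
theorem mulVec_eq_of_castSucc_eq_single {N m : ℕ} (hm : 0 < m)
    (V : Matrix (Fin N) (Fin (m + 1)) ℂ) (u : Fin (m + 1) → ℂ) (β : ℂ)
    (hu : ∀ j : Fin m, u j.castSucc = (β • (Pi.single ⟨0, hm⟩ 1 : Fin m → ℂ)) j) :
    V *ᵥ u = β • (fun i => V i 0) + u (Fin.last m) • (fun i => V i (Fin.last m)) := by
  ext i
  have h0 : (⟨0, hm⟩ : Fin m).castSucc = 0 := rfl
  simp [mulVec, dotProduct, Fin.sum_univ_castSucc, hu, Pi.single_apply, h0, mul_comm]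

/-- The leading rows of the shifted Hessenberg matrix form the shifted square Hessenberg matrix. -/
theorem shifted_hessenberg_castSucc {m : ℕ} (Hbar : Matrix (Fin (m + 1)) (Fin m) ℂ)
    (D : Matrix (Fin m) (Fin m) ℂ) (y : Fin m → ℂ) (j : Fin m) :
    (((Matrix.of fun (i : Fin (m + 1)) (j : Fin m) =>
        if (i : ℕ) = (j : ℕ) then (1 : ℂ) else 0) + Hbar * D) *ᵥ y) j.castSucc =
      ((1 + Hbar.submatrix Fin.castSucc id * D) *ᵥ y) j := by
  simp only [mulVec, dotProduct]
  refine Finset.sum_congr rfl fun l _ => ?_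
  simp [Matrix.mul_apply, Matrix.one_apply, Fin.ext_iff]

/-- The last row of the shifted Hessenberg matrix has only its last entry nonzero. -/
theorem shifted_hessenberg_last {m : ℕ} (hm : 0 < m) (Hbar : Matrix (Fin (m + 1)) (Fin m) ℂ)
    (hHess : ∀ (i : Fin (m + 1)) (j : Fin m), (j : ℕ) + 1 < (i : ℕ) → Hbar i j = 0)
    (τ : Fin m → ℂ) (z : ℂ) (y : Fin m → ℂ) :
    (((Matrix.of fun (i : Fin (m + 1)) (j : Fin m) =>
        if (i : ℕ) = (j : ℕ) then (1 : ℂ) else 0) + Hbar * (z • 1 - Matrix.diagonal τ)) *ᵥ y)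
        (Fin.last m) =
      Hbar (Fin.last m) ⟨m - 1, by omega⟩ * (z - τ ⟨m - 1, by omega⟩) * y ⟨m - 1, by omega⟩ := by
  have hD : z • (1 : Matrix (Fin m) (Fin m) ℂ) - Matrix.diagonal τ =
      Matrix.diagonal fun j => z - τ j := by
    rw [Matrix.smul_one_eq_diagonal, Matrix.diagonal_sub]
  rw [hD]
  simp only [mulVec, dotProduct]
  rw [Finset.sum_eq_single (⟨m - 1, by omega⟩ : Fin m)]
  · have : m ≠ m - 1 := by omega
    simp [Matrix.mul_diagonal, this]
  · intro j _ hj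
    have hj' : (j : ℕ) ≠ m - 1 := fun h => hj (Fin.ext h)
    have hlt := j.isLt
    have hz := hHess (Fin.last m) j (by rw [Fin.val_last]; omega)
    simp [Matrix.mul_diagonal, hz, hlt.ne']
  · simp

/-- error representation for the flexible Krylov approximation of the
quadrature sum `Σ_k w_k (A + z_k I)⁻¹ b`. Under the flexible Arnoldi relation,
`E_m = − Σ_k w_k η_k (A + z_k I)⁻¹ v_{m+1}` with
`η_k = h_{m+1,m}(z_k − τ_m)·(e_m^T H_m(z_k;T_m)⁻¹ β e_1)`; in particular `E_m` lies in
the span of the vectors `(A + z_k I)⁻¹ v_{m+1}`, `k = 1, …, N_z`. -/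
theorem flexible_krylov_quadrature_error {N m Nz : ℕ} (hm : 0 < m) (hmN : m ≤ N)
    (hNz : 0 < Nz)
    (A : Matrix (Fin N) (Fin N) ℂ)
    (V : Matrix (Fin N) (Fin (m + 1)) ℂ)
    (U : Matrix (Fin N) (Fin m) ℂ)
    (Hbar : Matrix (Fin (m + 1)) (Fin m) ℂ)
    (hHess : ∀ (i : Fin (m + 1)) (j : Fin m), (j : ℕ) + 1 < (i : ℕ) → Hbar i j = 0)
    (τ : Fin m → ℂ) (zs w : Fin Nz → ℂ) (β : ℂ) (b : Fin N → ℂ)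
    (HbarZ : Fin Nz → Matrix (Fin (m + 1)) (Fin m) ℂ)
    (hHbarZ : ∀ k, HbarZ k = (Matrix.of fun (i : Fin (m + 1)) (j : Fin m) =>
        if (i : ℕ) = (j : ℕ) then (1 : ℂ) else 0) + Hbar * (zs k • 1 - Matrix.diagonal τ))
    (Hz : Fin Nz → Matrix (Fin m) (Fin m) ℂ)
    (hHz : ∀ k, Hz k = 1 + Hbar.submatrix Fin.castSucc id * (zs k • 1 - Matrix.diagonal τ))
    (hHinv : ∀ k, IsUnit (Hz k))
    (hAinv : ∀ k, IsUnit (A + zs k • 1))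
    (hArn : ∀ k, (A + zs k • 1) * U = V * HbarZ k)
    (hb : b = β • (fun i => V i 0))
    (x : Fin Nz → Fin N → ℂ)
    (hx : ∀ k, x k = U.mulVec ((Hz k)⁻¹.mulVec (β • (Pi.single ⟨0, hm⟩ 1 : Fin m → ℂ))))
    (E : Fin N → ℂ)
    (hE : E = ∑ k, w k • ((A + zs k • 1)⁻¹.mulVec b - x k))
    (η : Fin Nz → ℂ)
    (hη : ∀ k, η k = Hbar (Fin.last m) ⟨m - 1, by omega⟩ * (zs k - τ ⟨m - 1, by omega⟩)
        * ((Hz k)⁻¹.mulVec (β • (Pi.single ⟨0, hm⟩ 1 : Fin m → ℂ))) ⟨m - 1, by omega⟩) :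
    E = -∑ k, (w k * η k) • (A + zs k • 1)⁻¹.mulVec (fun i => V i (Fin.last m)) ∧
    E ∈ Submodule.span ℂ
        (Set.range fun k : Fin Nz =>
          (A + zs k • 1)⁻¹.mulVec (fun i => V i (Fin.last m))) := by
  have key : ∀ k, (A + zs k • 1)⁻¹ *ᵥ b - x k =
      -(η k • (A + zs k • 1)⁻¹ *ᵥ (fun i => V i (Fin.last m))) := by
    intro k
    set y := (Hz k)⁻¹ *ᵥ (β • (Pi.single ⟨0, hm⟩ 1 : Fin m → ℂ)) with hy
    have hA := (Matrix.isUnit_iff_isUnit_det _).1 (hAinv k)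
    have hH := (Matrix.isUnit_iff_isUnit_det _).1 (hHinv k)
    have hHy : Hz k *ᵥ y = β • (Pi.single ⟨0, hm⟩ 1 : Fin m → ℂ) := by
      rw [hy, mulVec_mulVec, Matrix.mul_nonsing_inv _ hH, one_mulVec]
    have hres : (A + zs k • 1) *ᵥ x k = b + η k • (fun i => V i (Fin.last m)) := by
      rw [hx, mulVec_mulVec, hArn, ← mulVec_mulVec,
        mulVec_eq_of_castSucc_eq_single hm V (HbarZ k *ᵥ y) β, hb, hη, hHbarZ,
        shifted_hessenberg_last hm Hbar hHess]
      intro j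
      rw [hHbarZ, shifted_hessenberg_castSucc, ← hHz, hHy]
    have hxk : x k = (A + zs k • 1)⁻¹ *ᵥ (b + η k • (fun i => V i (Fin.last m))) := by
      rw [← hres, mulVec_mulVec, Matrix.nonsing_inv_mul _ hA, one_mulVec]
    rw [hxk, mulVec_add, mulVec_smul, sub_add_cancel_left]
  have hsum : E = -∑ k, (w k * η k) • (A + zs k • 1)⁻¹ *ᵥ (fun i => V i (Fin.last m)) := by
    simp only [hE, key, smul_neg, Finset.sum_neg_distrib, smul_smul]
  refine ⟨hsum, ?_⟩
  rw [hsum]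
  exact Submodule.neg_mem _ <| Submodule.sum_mem _ fun k _ =>
    Submodule.smul_mem _ _ <| Submodule.subset_span ⟨k, rfl⟩
end

section
/- Suppose H_m(z; T_m) is invertible, the flexible Arnoldi relation (A + z I) U_m = V_{m+1} H̄_m(z; T_m) holds, and b = β v_1. Then b − (A + z I) U_m H_m(z; T_m)^{-1} β e_1 = − η v_{m+1}, where η = h_{m+1,m} (z − τ_m) · (e_m^T H_m(z; T_m)^{-1} β e_1). -/
open Matrix

/-- A matrix with `m + 1` columns acts on a vector through its first `m` columns and its last. -/
theorem Matrix.mulVec_eq_submatrix_castSucc_add_last {R n : Type*} [CommSemiring R] {m : ℕ}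
    (V : Matrix n (Fin (m + 1)) R) (w : Fin (m + 1) → R) :
    V *ᵥ w = V.submatrix id Fin.castSucc *ᵥ (fun i => w i.castSucc)
      + w (Fin.last m) • fun i => V i (Fin.last m) := by
  ext i
  simp [Matrix.mulVec, dotProduct, Fin.sum_univ_castSucc, mul_comm]

/-- suppose `H_m(z; T_m)` is invertible, the flexible Arnoldi relation
`(A + z I) U_m = V_{m+1} H̄_m(z; T_m)` holds, and `b = β v_1`. Then
`b − (A + z I) U_m H_m(z; T_m)⁻¹ β e_1 = − η v_{m+1}`, where
`η = h_{m+1,m} (z − τ_m) · (e_m^T H_m(z; T_m)⁻¹ β e_1)`. -/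
theorem flexible_arnoldi_residual_formula {N m : ℕ} (hm : 0 < m) (hmN : m ≤ N)
    (A : Matrix (Fin N) (Fin N) ℂ)
    (V : Matrix (Fin N) (Fin (m + 1)) ℂ)
    (U : Matrix (Fin N) (Fin m) ℂ)
    (Hbar : Matrix (Fin (m + 1)) (Fin m) ℂ)
    (hHess : ∀ (i : Fin (m + 1)) (j : Fin m), (j : ℕ) + 1 < (i : ℕ) → Hbar i j = 0)
    (τ : Fin m → ℂ) (z β : ℂ) (b : Fin N → ℂ)
    (HbarZ : Matrix (Fin (m + 1)) (Fin m) ℂ)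
    (hHbarZ : HbarZ = (Matrix.of fun (i : Fin (m + 1)) (j : Fin m) =>
        if (i : ℕ) = (j : ℕ) then (1 : ℂ) else 0) + Hbar * (z • 1 - Matrix.diagonal τ))
    (Hz : Matrix (Fin m) (Fin m) ℂ)
    (hHz : Hz = 1 + Hbar.submatrix Fin.castSucc id * (z • 1 - Matrix.diagonal τ))
    (hinv : IsUnit Hz)
    (hArn : (A + z • 1) * U = V * HbarZ)
    (hb : b = β • (fun i => V i 0)) :
    b - (A + z • 1).mulVec (U.mulVec (Hz⁻¹.mulVec (β • (Pi.single ⟨0, hm⟩ 1 : Fin m → ℂ))))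
      = -(Hbar (Fin.last m) ⟨m - 1, by omega⟩ * (z - τ ⟨m - 1, by omega⟩)
            * (Hz⁻¹.mulVec (β • (Pi.single ⟨0, hm⟩ 1 : Fin m → ℂ))) ⟨m - 1, by omega⟩)
          • (fun i => V i (Fin.last m)) := by
  obtain ⟨k, rfl⟩ := Nat.exists_eq_add_one.mpr hm
  set y := Hz⁻¹ *ᵥ (β • (Pi.single ⟨0, hm⟩ 1 : Fin (k + 1) → ℂ)) with hy
  have hHzy : Hz *ᵥ y = β • Pi.single 0 1 := by
    rw [hy, mulVec_mulVec, mul_nonsing_inv _ ((isUnit_iff_isUnit_det _).mp hinv), one_mulVec]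
    rfl
  have hshift : z • (1 : Matrix (Fin (k + 1)) (Fin (k + 1)) ℂ) - diagonal τ
      = diagonal fun j => z - τ j := by
    rw [smul_one_eq_diagonal, diagonal_sub]
  have htop : (fun i : Fin (k + 1) => (HbarZ *ᵥ y) i.castSucc) = β • Pi.single 0 1 := by
    rw [← hHzy]
    ext i
    simp [hHbarZ, hHz, hshift, mulVec, dotProduct, one_apply, Fin.ext_iff]
  have hlast : (HbarZ *ᵥ y) (Fin.last (k + 1))
      = Hbar (Fin.last (k + 1)) (Fin.last k) * (z - τ (Fin.last k)) * y (Fin.last k) := by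
    have hentry (j : Fin (k + 1)) :
        HbarZ (Fin.last (k + 1)) j = Hbar (Fin.last (k + 1)) j * (z - τ j) := by
      simp [hHbarZ, hshift, j.isLt.ne']
    rw [mulVec, dotProduct, Fintype.sum_eq_single (Fin.last k), hentry]
    intro j hj
    have hlt : (j : ℕ) < k := Fin.lt_last_iff_ne_last.mpr hj
    rw [hentry, hHess _ _ (by simpa using hlt), zero_mul, zero_mul]
  have hAUy : (A + z • 1) *ᵥ (U *ᵥ y) = V *ᵥ (HbarZ *ᵥ y) := by
    simp only [mulVec_mulVec y, hArn]
  have hfirst : V.submatrix id Fin.castSucc *ᵥ (β • Pi.single 0 1) = b := by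
    rw [hb, mulVec_smul, mulVec_single_one]
    rfl
  rw [hAUy, mulVec_eq_submatrix_castSucc_add_last, htop, hlast, hfirst, sub_add_cancel_left,
    neg_smul]
  rfl
end

section
/- Suppose the flexible Arnoldi recurrence A V_{m+1} H̄_m + V_{m+1} H̄_m T_m = V_m holds (equivalently, with U_m = V_{m+1} H̄_m one has A U_m + U_m T_m = V_m). Then the last Arnoldi vector satisfies the rational-function characterization ( Π_{j=1}^m h_{j+1,j} ) · ( Π_{j=1}^m (A + τ_j I) ) v_{m+1} = p(A) v_1, where p is the polynomial p(λ) = det( (I_m − H_m T_m) − λ H_m ) and p(A) denotes its evaluation at the matrix A. -/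
open Matrix Polynomial

/-- Cramer rule with the unknowns in a module. -/
theorem sum_adjugate_smul_sum {n R W : Type*} [Fintype n] [DecidableEq n] [CommRing R]
    [AddCommGroup W] [Module R W] (M : Matrix n n R) (w : n → W) (k : n) :
    ∑ j, M.adjugate k j • ∑ i, M j i • w i = M.det • w k := by
  simp_rw [Finset.smul_sum, smul_smul]
  rw [Finset.sum_comm]
  simp_rw [← Finset.sum_smul, ← Matrix.mul_apply, Matrix.adjugate_mul, Matrix.smul_apply,
    Matrix.one_apply, smul_eq_mul, mul_ite, mul_one, mul_zero, ite_smul, zero_smul]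
  simp

/-- If `w` is annihilated by the columns of an `(m + 1) × m` matrix, then its first and last
entries are proportional to complementary maximal minors. -/
theorem det_castSucc_smul_zero_eq {m : ℕ} {R W : Type*} [CommRing R] [AddCommGroup W]
    [Module R W] (B : Matrix (Fin (m + 1)) (Fin m) R) (w : Fin (m + 1) → W)
    (h : ∀ j, ∑ i, B i j • w i = 0) :
    ((-1) ^ m * (B.submatrix Fin.castSucc id).det) • w 0 =
      (B.submatrix Fin.succ id).det • w (Fin.last m) := by
  let C : Matrix (Fin (m + 1)) (Fin (m + 1)) R :=
    Matrix.of fun j i => Fin.cons (α := fun _ => R) (if i = Fin.last m then 1 else 0) (B i) j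
  have hdet : C.det = (-1) ^ m * (B.submatrix Fin.castSucc id).det := by
    rw [Matrix.det_succ_row_zero, Finset.sum_eq_single (Fin.last m)]
    · rw [← Matrix.det_transpose (B.submatrix _ _)]
      simp only [C, Matrix.of_apply, Fin.cons_zero, if_true, Fin.val_last, mul_one]
      congr 2
      ext i j
      simp
    · intro i _ hi
      simp [C, hi]
    · simp
  have hadj : C.adjugate 0 0 = (B.submatrix Fin.succ id).det := by
    rw [Matrix.adjugate_fin_succ_eq_det_submatrix, ← Matrix.det_transpose (B.submatrix _ _)]
    simp only [Fin.val_zero, add_zero, pow_zero, one_mul]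
    congr 1
  rw [← hdet, ← sum_adjugate_smul_sum C w 0, Fin.sum_univ_succ, hadj]
  simp [C, h]

/-- rational-function characterization of the last flexible Arnoldi vector.
If `A V_{m+1} H̄_m + V_{m+1} H̄_m T_m = V_m` (i.e. `A U_m + U_m T_m = V_m` with
`U_m = V_{m+1} H̄_m`), then
`(Π_j h_{j+1,j}) · (Π_j (A + τ_j I)) v_{m+1} = p(A) v_1`, where
`p(λ) = det((I_m − H_m T_m) − λ H_m)`. -/
theorem arnoldi_rational_characterization {N m : ℕ} (hm : 0 < m) (hmN : m ≤ N)
    (A : Matrix (Fin N) (Fin N) ℂ)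
    (V : Matrix (Fin N) (Fin (m + 1)) ℂ)
    (Hbar : Matrix (Fin (m + 1)) (Fin m) ℂ)
    (hHess : ∀ (i : Fin (m + 1)) (j : Fin m), (j : ℕ) + 1 < (i : ℕ) → Hbar i j = 0)
    (τ : Fin m → ℂ)
    (hrec : A * (V * Hbar) + (V * Hbar) * Matrix.diagonal τ = V.submatrix id Fin.castSucc) :
    (∏ j : Fin m, Hbar (Fin.succ j) j) •
        ((((List.finRange m).map (fun j => A + τ j • 1)).prod).mulVec (fun i => V i (Fin.last m)))
      = (Polynomial.aeval A
            (((1 - Hbar.submatrix Fin.castSucc id * Matrix.diagonal τ).map Polynomial.C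
              - (Polynomial.X : Polynomial ℂ) • ((Hbar.submatrix Fin.castSucc id).map Polynomial.C)).det)).mulVec
          (fun i => V i 0) := by
  let _ : Module ℂ[X] (Fin N → ℂ) :=
    Module.compHom _ (Polynomial.aeval (R := ℂ) (Matrix.toLin' A)).toRingHom
  have smul_def (p : ℂ[X]) (x : Fin N → ℂ) : p • x = (Polynomial.aeval A p).mulVec x := by
    change Polynomial.aeval (Matrix.toLinAlgEquiv' A) p x = _
    rw [Polynomial.aeval_algHom_apply]
    rfl
  let B : Matrix (Fin (m + 1)) (Fin m) ℂ[X] := Matrix.of fun i j =>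
    (if i = j.castSucc then 1 else 0) - C (Hbar i j) * (X + C (τ j))
  have hB (j : Fin m) : ∑ i, B i j • (fun k => V k i) = 0 := by
    have hterm (i : Fin (m + 1)) : B i j • (fun k => V k i) =
        (if i = j.castSucc then fun k => V k i else 0) -
          Hbar i j • (A.mulVec (fun k => V k i) + τ j • fun k => V k i) := by
      have hone : (if i = j.castSucc then (1 : ℂ[X]) else 0) • (fun k => V k i) =
          if i = j.castSucc then fun k => V k i else 0 := by
        split_ifs
        · exact one_smul _ _
        · exact zero_smul _ _
      have hBij : B i j = (if i = j.castSucc then 1 else 0) - C (Hbar i j) * (X + C (τ j)) := rfl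
      rw [hBij, sub_smul, hone, smul_def]
      simp [Algebra.algebraMap_eq_smul_one, Matrix.add_mulVec, Matrix.smul_mulVec]
    have hcol : A.mulVec (fun k => ∑ i, V k i * Hbar i j) + τ j • (fun k => ∑ i, V k i * Hbar i j)
        = fun k => V k j.castSucc := by
      ext k
      have hk := congrFun (congrFun hrec k) j
      rw [Matrix.add_apply, Matrix.mul_diagonal] at hk
      simpa [Matrix.mul_apply, Matrix.mulVec, dotProduct, mul_comm] using hk
    have hU : (fun k => ∑ i, V k i * Hbar i j) = ∑ i, Hbar i j • fun k => V k i := by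
      ext k
      simp [mul_comm]
    simp_rw [hterm]
    rw [Finset.sum_sub_distrib, Finset.sum_ite_eq', if_pos (Finset.mem_univ _), ← hcol, hU,
      Matrix.mulVec_sum, Finset.smul_sum, ← Finset.sum_add_distrib, sub_eq_zero]
    refine Finset.sum_congr rfl fun i _ => ?_
    rw [Matrix.mulVec_smul, smul_add, smul_comm (τ j)]
  have htop : B.submatrix Fin.castSucc id =
      (1 - Hbar.submatrix Fin.castSucc id * Matrix.diagonal τ).map C
        - (X : ℂ[X]) • (Hbar.submatrix Fin.castSucc id).map C := by
    ext1 i j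
    simp only [B, Matrix.submatrix_apply, Matrix.of_apply, id, Matrix.sub_apply, Matrix.map_apply,
      Matrix.smul_apply, Matrix.mul_diagonal, Matrix.one_apply, Fin.castSucc_inj, smul_eq_mul,
      map_sub, map_mul, apply_ite C, map_one, map_zero]
    ring
  have hbot : (B.submatrix Fin.succ id).det =
      (-1) ^ m * (C (∏ j : Fin m, Hbar j.succ j) * ∏ j : Fin m, (X + C (τ j))) := by
    rw [Matrix.det_of_isUpperTriangular]
    · have hne (j : Fin m) : j.succ ≠ j.castSucc := Fin.castSucc_lt_succ.ne'
      simp [B, hne, Finset.prod_neg, Finset.prod_mul_distrib, map_prod]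
    · intro i j hij
      have hlt : j < i := hij
      have hne : i.succ ≠ j.castSucc := (Fin.castSucc_lt_succ.trans (Fin.succ_lt_succ_iff.2 hlt)).ne'
      have h0 : Hbar i.succ j = 0 := hHess _ _ (by simpa using hlt)
      simp [B, hne, h0]
  have hprod : Polynomial.aeval A (∏ j : Fin m, (X + C (τ j))) =
      ((List.finRange m).map fun j => A + τ j • 1).prod := by
    rw [← List.prod_ofFn, map_list_prod, List.ofFn_eq_map, List.map_map]
    congr 2
    ext1 j
    simp [Algebra.algebraMap_eq_smul_one]
  have key := det_castSucc_smul_zero_eq B (fun i k => V k i) hB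
  rw [htop, hbot, mul_smul, mul_smul, ((isUnit_one.neg).pow m).smul_left_cancel] at key
  rw [smul_def, smul_def, map_mul, Polynomial.aeval_C, hprod, ← Algebra.smul_def,
    Matrix.smul_mulVec] at key
  exact key.symm
end

section
/- Suppose that for each j = 1, …, m the matrix K + τ_j M is invertible, the vectors u_j satisfy (K + τ_j M) u_j = v_j, and the Arnoldi orthogonalization relation M U_m = V_{m+1} H̄_m holds, where U_m = [u_1, …, u_m]. Then for every complex number z the modified Arnoldi relation (K + z M) U_m = V_{m+1} H̄_m(z; T_m) holds, where H̄_m(z; T_m) = [I_m; 0] + H̄_m (z I_m − T_m). -/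
open Matrix

/-- if each `K + τ_j M` is invertible, the vectors `u_j` (the columns of `U_m`)
satisfy `(K + τ_j M) u_j = v_j`, and the Arnoldi orthogonalization relation
`M U_m = V_{m+1} H̄_m` holds, then for every `z ∈ ℂ` the modified Arnoldi relation
`(K + z M) U_m = V_{m+1} H̄_m(z; T_m)` holds, where
`H̄_m(z; T_m) = [I_m; 0] + H̄_m (z I_m − T_m)` and `T_m = diag(τ_1, …, τ_m)`. -/
theorem modified_arnoldi_relation {N m : ℕ} (hm : 0 < m) (hmN : m ≤ N)
    (K M : Matrix (Fin N) (Fin N) ℂ)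
    (V : Matrix (Fin N) (Fin (m + 1)) ℂ)
    (Hbar : Matrix (Fin (m + 1)) (Fin m) ℂ)
    (τ : Fin m → ℂ)
    (U : Matrix (Fin N) (Fin m) ℂ)
    (hinv : ∀ j : Fin m, IsUnit (K + τ j • M))
    (hu : ∀ j : Fin m,
      (K + τ j • M).mulVec (fun i => U i j) = fun i => V i (Fin.castSucc j))
    (hMU : M * U = V * Hbar) :
    ∀ z : ℂ, (K + z • M) * U
      = V * ((Matrix.of fun (i : Fin (m + 1)) (j : Fin m) =>
                if (i : ℕ) = (j : ℕ) then (1 : ℂ) else 0)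
              + Hbar * (z • 1 - Matrix.diagonal τ)) := by
  intro z
  rw [Matrix.mul_add, ← Matrix.mul_assoc, ← hMU]
  ext i j
  have hcol : (K * U) i j + τ j * (M * U) i j = V i (Fin.castSucc j) := by
    simpa [Matrix.mulVec, dotProduct, Matrix.mul_apply, add_mul, Finset.sum_add_distrib,
      Finset.mul_sum, mul_assoc] using congrFun (hu j) i
  have hpad : (V * Matrix.of fun (i : Fin (m + 1)) (j : Fin m) =>
      if (i : ℕ) = (j : ℕ) then (1 : ℂ) else 0) i j = V i (Fin.castSucc j) := by
    rw [Matrix.mul_apply, Finset.sum_eq_single (Fin.castSucc j)]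
    · simp
    · intro k _ hk
      have hne : (k : ℕ) ≠ j := fun h => hk (Fin.ext h)
      simp [hne]
    · simp
  rw [Matrix.add_apply, hpad, ← hcol, Matrix.mul_sub, Matrix.sub_apply, Matrix.mul_diagonal,
    Matrix.mul_smul, Matrix.mul_one, Matrix.add_mul, Matrix.smul_mul]
  simp only [Matrix.add_apply, Matrix.smul_apply, smul_eq_mul]
  ring
end

section
/- Suppose the pair (ξ, β*) ∈ ℝ^{N_y} × ℝ^p solves the saddle-point system ( J Q Jᵀ + R ) ξ + J X β* = y and (J X)ᵀ ξ = 0, and define s* = X β* + Q Jᵀ ξ. Then (s*, β*) is a global minimizer of the geostatistical objective f(s, β) = (1/2) (y − J s)ᵀ R^{-1} (y − J s) + (1/2) (s − X β)ᵀ Q^{-1} (s − X β) over all (s, β) ∈ ℝ^{N_s} × ℝ^p. -/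
open Matrix

/-- The tangent-plane inequality at `A *ᵥ w` for the convex quadratic form `v ↦ vᵀ A⁻¹ v`. -/
theorem Matrix.PosDef.quadForm_inv_add_le {n : Type*} [Fintype n] [DecidableEq n]
    {A : Matrix n n ℝ} (hA : A.PosDef) (w v : n → ℝ) :
    (A *ᵥ w) ⬝ᵥ (A⁻¹ *ᵥ (A *ᵥ w)) + 2 * (w ⬝ᵥ (v - A *ᵥ w)) ≤ v ⬝ᵥ (A⁻¹ *ᵥ v) := by
  have hinv : A⁻¹ *ᵥ (A *ᵥ w) = w := by
    rw [mulVec_mulVec, nonsing_inv_mul A ((isUnit_iff_isUnit_det A).1 hA.isUnit), one_mulVec]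
  have hsymm : (A⁻¹)ᵀ = A⁻¹ := by
    simpa using hA.inv.isHermitian.eq
  have hcross : (A *ᵥ w) ⬝ᵥ (A⁻¹ *ᵥ v) = w ⬝ᵥ v := by
    rw [dotProduct_mulVec, ← mulVec_transpose, hsymm, hinv]
  have hnonneg : 0 ≤ (v - A *ᵥ w) ⬝ᵥ (A⁻¹ *ᵥ (v - A *ᵥ w)) := by
    simpa using hA.inv.posSemidef.dotProduct_mulVec_nonneg (v - A *ᵥ w)
  rw [mulVec_sub, hinv, sub_dotProduct, dotProduct_sub, dotProduct_sub, hcross,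
    dotProduct_comm v w, dotProduct_comm (A *ᵥ w) w] at hnonneg
  rw [hinv, dotProduct_sub, dotProduct_comm (A *ᵥ w) w]
  linarith

/-- if `(ξ, β*)` solves the saddle-point system
`(J Q Jᵀ + R) ξ + J X β* = y`, `(J X)ᵀ ξ = 0`, and `s* = X β* + Q Jᵀ ξ`, then `(s*, β*)`
is a global minimizer of the geostatistical objective
`f(s, β) = ½ (y − J s)ᵀ R⁻¹ (y − J s) + ½ (s − X β)ᵀ Q⁻¹ (s − X β)`. -/
theorem geostatistical_saddle_point_minimizer {Ns Ny p : ℕ}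
    (Q : Matrix (Fin Ns) (Fin Ns) ℝ) (hQ : Q.PosDef)
    (R : Matrix (Fin Ny) (Fin Ny) ℝ) (hR : R.PosDef)
    (J : Matrix (Fin Ny) (Fin Ns) ℝ) (X : Matrix (Fin Ns) (Fin p) ℝ)
    (y : Fin Ny → ℝ) (ξ : Fin Ny → ℝ) (βs : Fin p → ℝ)
    (hsys1 : (J * Q * Jᵀ + R).mulVec ξ + (J * X).mulVec βs = y)
    (hsys2 : (J * X)ᵀ.mulVec ξ = 0)
    (ss : Fin Ns → ℝ)
    (hss : ss = X.mulVec βs + (Q * Jᵀ).mulVec ξ) :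
    ∀ (s : Fin Ns → ℝ) (β : Fin p → ℝ),
      (1 / 2) * ((y - J.mulVec ss) ⬝ᵥ R⁻¹.mulVec (y - J.mulVec ss))
        + (1 / 2) * ((ss - X.mulVec βs) ⬝ᵥ Q⁻¹.mulVec (ss - X.mulVec βs))
      ≤ (1 / 2) * ((y - J.mulVec s) ⬝ᵥ R⁻¹.mulVec (y - J.mulVec s))
        + (1 / 2) * ((s - X.mulVec β) ⬝ᵥ Q⁻¹.mulVec (s - X.mulVec β)) := by
  intro s β
  have hres : y - J *ᵥ ss = R *ᵥ ξ := by
    rw [← hsys1, hss]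
    simp only [add_mulVec, mulVec_add, mulVec_mulVec, Matrix.mul_assoc]
    abel
  have hdev : ss - X *ᵥ βs = Q *ᵥ (Jᵀ *ᵥ ξ) := by
    rw [hss, mulVec_mulVec, add_sub_cancel_left]
  have horth (γ : Fin p → ℝ) : ξ ⬝ᵥ (J *ᵥ (X *ᵥ γ)) = 0 := by
    rw [mulVec_mulVec, dotProduct_mulVec, ← mulVec_transpose, hsys2, zero_dotProduct]
  have hadj (u : Fin Ns → ℝ) : (Jᵀ *ᵥ ξ) ⬝ᵥ u = ξ ⬝ᵥ (J *ᵥ u) := by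
    rw [mulVec_transpose, dotProduct_mulVec]
  have hlin : ξ ⬝ᵥ (y - J *ᵥ s - R *ᵥ ξ)
      + (Jᵀ *ᵥ ξ) ⬝ᵥ (s - X *ᵥ β - Q *ᵥ (Jᵀ *ᵥ ξ)) = 0 := by
    rw [← hres, ← hdev, hadj]
    simp only [mulVec_sub, dotProduct_sub, horth]
    ring
  have hR' := hR.quadForm_inv_add_le ξ (y - J *ᵥ s)
  have hQ' := hQ.quadForm_inv_add_le (Jᵀ *ᵥ ξ) (s - X *ᵥ β)
  rw [hres, hdev]
  linarith
end
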